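/- With the CGMY data below, let a > 0 be such that θ₀(w) < 0 and Re ψ₀(w) < 0 for all w ≥ a. Then lim_{t→0⁺} (1/t)·∫ₐ^∞ Re(exp(t·θ₀(w)) - exp(t·ψ₀(w)))/(w² + 1/4) dw = ∫ₐ^∞ (θ₀(w) - Re ψ₀(w))/(w² + 1/4) dw, and the limiting integral converges absolutely. -/

import Mathlib

open MeasureTheory Filter Topology Complex

/-- The stable scale coefficient `σ_Y = 2·C·Γ(-Y)·|cos(πY/2)|`. -/
noncomputable def sigmaY (C Y : ℝ) : ℝ :=
  2 * C * Real.Gamma (-Y) * |Real.cos (Real.pi * Y / 2)|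

/-- The martingale drift `b̃`. -/
noncomputable def btilde (C G M Y : ℝ) : ℝ :=
  -(C * Real.Gamma (-Y) * ((M - 1) ^ Y + (G + 1) ^ Y - M ^ Y - G ^ Y))

/-- The constant `κ = b̃/2 - C·Γ(-Y)·(M^Y + G^Y)`. -/
noncomputable def kappaC (C G M Y : ℝ) : ℝ :=
  btilde C G M Y / 2 - C * Real.Gamma (-Y) * (M ^ Y + G ^ Y)

/-- The limiting stable exponent `θ₀(u) = -σ_Y·|u|^Y`. -/
noncomputable def theta0 (C Y : ℝ) (u : ℝ) : ℝ :=
  -(sigmaY C Y) * |u| ^ Y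

/-- The contour-shifted characteristic exponent `ψ₀`. -/
noncomputable def psi0 (C G M Y : ℝ) (v : ℝ) : ℂ :=
  Complex.I * (v : ℂ) * ((btilde C G M Y : ℝ) : ℂ) + ((kappaC C G M Y : ℝ) : ℂ)
    + ((C * Real.Gamma (-Y) : ℝ) : ℂ) *
      ((((M - 1/2 : ℝ) : ℂ) - Complex.I * (v : ℂ)) ^ (Y : ℂ)
        + (((G + 1/2 : ℝ) : ℂ) + Complex.I * (v : ℂ)) ^ (Y : ℂ))

/-- The rescaled exponent `θ(t,v)` in the Lipton–Lewis representation. -/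
noncomputable def thetaT (C G M Y : ℝ) (t v : ℝ) : ℂ :=
  Complex.I * (v : ℂ) * ((btilde C G M Y : ℝ) : ℂ) * ((t ^ (1 - 1/Y) : ℝ) : ℂ)
    + ((kappaC C G M Y : ℝ) : ℂ) * (t : ℂ)
    + ((C * Real.Gamma (-Y) : ℝ) : ℂ) *
      (((((M - 1/2) * t ^ (1/Y) : ℝ) : ℂ) - Complex.I * (v : ℂ)) ^ (Y : ℂ)
        + ((((G + 1/2) * t ^ (1/Y) : ℝ) : ℂ) + Complex.I * (v : ℂ)) ^ (Y : ℂ))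

/-- The normalized Lipton–Lewis ATM factor `L(t)`. -/
noncomputable def LLfn (C G M Y : ℝ) (t : ℝ) : ℝ :=
  (1 / Real.pi) *
    (∫ v in Set.Ioi (0 : ℝ),
      (1 - Complex.exp (thetaT C G M Y t v)) / (((v ^ 2 + t ^ (2/Y) / 4 : ℝ)) : ℂ)).re

/-- The first-order coefficient `d₁`. -/
noncomputable def dOne (C Y : ℝ) : ℝ :=
  (1 / Real.pi) * Real.Gamma (1 - 1/Y) * (sigmaY C Y) ^ (1/Y)

/-- The second-order coefficient `d₂`. -/
noncomputable def dTwo (C G M Y : ℝ) : ℝ :=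
  (1 / Real.pi) * ∫ w in Set.Ioi (0 : ℝ),
    ((w ^ 2 + 1/4) * theta0 C Y w - w ^ 2 * (psi0 C G M Y w).re) / (w ^ 2 * (w ^ 2 + 1/4))

/-- Adding a nonnegative real `m` to the imaginary number `i v` changes its `Y`-th power by at
most `m Y (m + |v|)^(Y - 1)`. -/
lemma norm_add_I_mul_cpow_sub_le {Y m v : ℝ} (hY : 1 < Y) (hm : 0 ≤ m) (hv : v ≠ 0) :
    ‖((m : ℂ) + I * (v : ℂ)) ^ (Y : ℂ) - (I * (v : ℂ)) ^ (Y : ℂ)‖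
      ≤ Y * (m + |v|) ^ (Y - 1) * m := by
  have hderiv : ∀ x ∈ Set.Icc 0 m, HasDerivWithinAt
      (fun x : ℝ => ((x : ℂ) + I * (v : ℂ)) ^ (Y : ℂ))
      ((Y : ℂ) * ((x : ℂ) + I * (v : ℂ)) ^ ((Y : ℂ) - 1) * 1) (Set.Icc 0 m) x := by
    intro x _
    have h : HasDerivAt (fun z : ℂ => (z + I * (v : ℂ)) ^ (Y : ℂ))
        ((Y : ℂ) * ((x : ℂ) + I * (v : ℂ)) ^ ((Y : ℂ) - 1) * 1) (x : ℂ) :=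
      ((hasDerivAt_id (x : ℂ)).add_const (I * (v : ℂ))).cpow_const
        (mem_slitPlane_iff.mpr (Or.inr (by simpa using hv)))
    exact h.comp_ofReal.hasDerivWithinAt
  have hbound : ∀ x ∈ Set.Ico 0 m,
      ‖(Y : ℂ) * ((x : ℂ) + I * (v : ℂ)) ^ ((Y : ℂ) - 1) * 1‖ ≤ Y * (m + |v|) ^ (Y - 1) := by
    intro x hx
    have hnorm : ‖(x : ℂ) + I * (v : ℂ)‖ ≤ m + |v| := by
      refine (norm_add_le _ _).trans ?_
      simp only [norm_real, norm_mul, norm_I, one_mul, Real.norm_eq_abs, abs_of_nonneg hx.1]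
      linarith [hx.2]
    rw [mul_one, norm_mul, ← ofReal_one, ← ofReal_sub, norm_cpow_real, norm_real,
      Real.norm_of_nonneg (by linarith)]
    gcongr
  simpa using norm_image_sub_le_of_norm_deriv_le_segment' hderiv hbound m ⟨hm, le_rfl⟩

lemma I_mul_cpow_add_neg_I_mul_cpow {w : ℝ} (hw : 0 < w) (Y : ℝ) :
    (I * (w : ℂ)) ^ (Y : ℂ) + (I * ((-w : ℝ) : ℂ)) ^ (Y : ℂ)
      = ((2 * Real.cos (Real.pi * Y / 2) * w ^ Y : ℝ) : ℂ) := by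
  have hw' : (w : ℂ) ≠ 0 := ofReal_ne_zero.mpr hw.ne'
  have hneg : I * ((-w : ℝ) : ℂ) = (w : ℂ) * -I := by push_cast; ring
  rw [hneg, mul_comm I, cpow_def_of_ne_zero (mul_ne_zero hw' I_ne_zero),
    cpow_def_of_ne_zero (mul_ne_zero hw' (neg_ne_zero.mpr I_ne_zero)),
    log_ofReal_mul hw I_ne_zero, log_ofReal_mul hw (neg_ne_zero.mpr I_ne_zero), log_I, log_neg_I,
    Real.rpow_def_of_pos hw]
  push_cast
  rw [Complex.two_cos, add_mul, add_mul, Complex.exp_add, Complex.exp_add]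
  ring_nf

lemma theta0_of_pos {Y w : ℝ} (C : ℝ) (hY1 : 1 < Y) (hY2 : Y < 2) (hw : 0 < w) :
    theta0 C Y w = C * Real.Gamma (-Y) * (2 * Real.cos (Real.pi * Y / 2) * w ^ Y) := by
  have hcos : Real.cos (Real.pi * Y / 2) < 0 :=
    Real.cos_neg_of_pi_div_two_lt_of_lt (by nlinarith [Real.pi_pos]) (by nlinarith [Real.pi_pos])
  rw [theta0, sigmaY, abs_of_neg hcos, abs_of_pos hw]
  ring

/-- Up to the linear drift term, `ψ₀` and `θ₀` differ by `O(w^(Y - 1))` at infinity. -/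
lemma exists_norm_psi0_sub_le (C : ℝ) {G M Y : ℝ} (hG : 0 ≤ G) (hM : 1 < M)
    (hY1 : 1 < Y) (hY2 : Y < 2) :
    ∃ K : ℝ, 0 ≤ K ∧ ∀ᶠ w : ℝ in atTop,
      ‖psi0 C G M Y w - (theta0 C Y w : ℂ) - I * ((w * btilde C G M Y : ℝ) : ℂ)‖
        ≤ K * w ^ (Y - 1) := by
  set A := C * Real.Gamma (-Y) with hA
  refine ⟨|kappaC C G M Y| + |A| * (Y * 2 ^ (Y - 1) * (M - 1/2) + Y * 2 ^ (Y - 1) * (G + 1/2)),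
    ?_, ?_⟩
  · have h1 : 0 ≤ M - 1/2 := by linarith
    positivity
  filter_upwards [eventually_ge_atTop 1, eventually_ge_atTop (M - 1/2),
    eventually_ge_atTop (G + 1/2)] with w hw1 hwM hwG
  have hw : 0 < w := by linarith
  have hpow : ∀ m : ℝ, 0 ≤ m → m ≤ w → ∀ v : ℝ, |v| = w →
      ‖((m : ℂ) + I * (v : ℂ)) ^ (Y : ℂ) - (I * (v : ℂ)) ^ (Y : ℂ)‖
        ≤ Y * 2 ^ (Y - 1) * m * w ^ (Y - 1) := by
    intro m hm hmw v hv
    refine (norm_add_I_mul_cpow_sub_le hY1 hm (abs_pos.mp (hv ▸ hw))).trans ?_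
    have : (m + |v|) ^ (Y - 1) ≤ 2 ^ (Y - 1) * w ^ (Y - 1) := by
      rw [← Real.mul_rpow zero_le_two hw.le, hv]
      exact Real.rpow_le_rpow (by linarith) (by linarith) (by linarith)
    calc Y * (m + |v|) ^ (Y - 1) * m ≤ Y * (2 ^ (Y - 1) * w ^ (Y - 1)) * m := by gcongr
      _ = _ := by ring
  have hMw := hpow (M - 1/2) (by linarith) hwM (-w) (by rw [abs_neg, abs_of_pos hw])
  have hGw := hpow (G + 1/2) (by linarith) hwG w (abs_of_pos hw)
  have hone : 1 ≤ w ^ (Y - 1) := Real.one_le_rpow hw1 (by linarith)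
  have hdecomp : psi0 C G M Y w - (theta0 C Y w : ℂ) - I * ((w * btilde C G M Y : ℝ) : ℂ)
      = (kappaC C G M Y : ℂ) + (A : ℂ) *
        ((((M - 1/2 : ℝ) : ℂ) + I * ((-w : ℝ) : ℂ)) ^ (Y : ℂ) - (I * ((-w : ℝ) : ℂ)) ^ (Y : ℂ)
          + ((((G + 1/2 : ℝ) : ℂ) + I * (w : ℂ)) ^ (Y : ℂ) - (I * (w : ℂ)) ^ (Y : ℂ))) := by
    have hsub : ((M - 1/2 : ℝ) : ℂ) + I * ((-w : ℝ) : ℂ) = ((M - 1/2 : ℝ) : ℂ) - I * (w : ℂ) := by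
      push_cast; ring
    rw [theta0_of_pos C hY1 hY2 hw, ← hA, ofReal_mul A, ← I_mul_cpow_add_neg_I_mul_cpow hw, hsub,
      psi0, ← hA, ofReal_mul w]
    ring
  rw [hdecomp]
  calc _ ≤ |kappaC C G M Y| + |A| * (Y * 2 ^ (Y - 1) * (M - 1/2) * w ^ (Y - 1)
        + Y * 2 ^ (Y - 1) * (G + 1/2) * w ^ (Y - 1)) := by
        refine (norm_add_le _ _).trans ?_
        rw [norm_mul, norm_real, norm_real, Real.norm_eq_abs, Real.norm_eq_abs]
        gcongr
        exact (norm_add_le _ _).trans (add_le_add hMw hGw)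
    _ ≤ |kappaC C G M Y| * w ^ (Y - 1) + |A| * (Y * 2 ^ (Y - 1) * (M - 1/2) * w ^ (Y - 1)
        + Y * 2 ^ (Y - 1) * (G + 1/2) * w ^ (Y - 1)) := by
        gcongr
        exact le_mul_of_one_le_right (abs_nonneg _) hone
    _ = _ := by ring

lemma continuous_theta0 (C : ℝ) {Y : ℝ} (hY : 0 ≤ Y) : Continuous (theta0 C Y) :=
  continuous_const.mul (continuous_abs.rpow_const fun _ => Or.inr hY)

lemma continuous_psi0 (C : ℝ) {G M : ℝ} (Y : ℝ) (hG : 0 ≤ G) (hM : 1 < M) :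
    Continuous (psi0 C G M Y) := by
  have hpowM : Continuous fun v : ℝ => (((M - 1/2 : ℝ) : ℂ) - I * (v : ℂ)) ^ (Y : ℂ) :=
    (by fun_prop : Continuous fun v : ℝ => ((M - 1/2 : ℝ) : ℂ) - I * (v : ℂ)).cpow
      continuous_const fun v => mem_slitPlane_iff.mpr <| Or.inl <| by
        have : 0 < M - 1/2 := by linarith
        simpa using this
  have hpowG : Continuous fun v : ℝ => (((G + 1/2 : ℝ) : ℂ) + I * (v : ℂ)) ^ (Y : ℂ) :=
    (by fun_prop : Continuous fun v : ℝ => ((G + 1/2 : ℝ) : ℂ) + I * (v : ℂ)).cpow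
      continuous_const fun v => mem_slitPlane_iff.mpr <| Or.inl <| by
        have : 0 < G + 1/2 := by linarith
        simpa using this
  unfold psi0
  exact (by fun_prop : Continuous fun v : ℝ =>
    I * (v : ℂ) * ((btilde C G M Y : ℝ) : ℂ) + ((kappaC C G M Y : ℝ) : ℂ)).add
    (continuous_const.mul (hpowM.add hpowG))

lemma integrableOn_Ioi_of_norm_le_rpow {f : ℝ → ℝ} {a s K : ℝ} (hf : ContinuousOn f (Set.Ici a))
    (hs : s < -1) (hK : ∀ᶠ w in atTop, |f w| ≤ K * w ^ s) : IntegrableOn f (Set.Ioi a) := by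
  refine ((hf.locallyIntegrableOn measurableSet_Ici).integrableOn_of_isBigO_atTop
    (g := fun w : ℝ => w ^ s) (Asymptotics.IsBigO.of_bound K ?_)
    (integrableAtFilter_rpow_atTop_iff.mpr hs)).mono_set Set.Ioi_subset_Ici_self
  filter_upwards [hK, eventually_gt_atTop 0] with w hw hw0
  rwa [Real.norm_eq_abs, Real.norm_of_nonneg (Real.rpow_nonneg hw0.le s)]

lemma abs_exp_sub_exp_le_of_nonpos {u v : ℝ} (hu : u ≤ 0) (hv : v ≤ 0) :
    |Real.exp u - Real.exp v| ≤ |u - v| := by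
  wlog h : v ≤ u generalizing u v
  · rw [abs_sub_comm, abs_sub_comm u]
    exact this hv hu (le_of_not_ge h)
  rw [abs_of_nonneg (sub_nonneg.mpr (Real.exp_le_exp.mpr h)), abs_of_nonneg (sub_nonneg.mpr h)]
  have h1 : Real.exp v = Real.exp u * Real.exp (v - u) := by rw [← Real.exp_add]; ring_nf
  have h2 := Real.add_one_le_exp (v - u)
  have h3 : Real.exp u ≤ 1 := Real.exp_le_one_iff.mpr hu
  rw [h1]
  nlinarith [Real.exp_pos u]

/-- Comparison of the exponentials of a negative real number and of a complex number with
negative real part; the phase costs `t (Im z)² / |Re z|`. -/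
lemma abs_re_exp_sub_exp_le {t θ : ℝ} {z : ℂ} (ht : 0 < t) (hθ : θ < 0) (hz : z.re < 0) :
    |(Complex.exp ((t * θ : ℝ) : ℂ) - Complex.exp ((t : ℂ) * z)).re|
      ≤ t * (|θ - z.re| + z.im ^ 2 / (-z.re)) := by
  have hre : (Complex.exp ((t * θ : ℝ) : ℂ) - Complex.exp ((t : ℂ) * z)).re
      = (Real.exp (t * θ) - Real.exp (t * z.re))
        + Real.exp (t * z.re) * (1 - Real.cos (t * z.im)) := by
    rw [sub_re, ← ofReal_exp, ofReal_re, exp_re]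
    simp only [re_ofReal_mul, im_ofReal_mul]
    ring
  have hexp : |Real.exp (t * θ) - Real.exp (t * z.re)| ≤ t * |θ - z.re| := by
    refine (abs_exp_sub_exp_le_of_nonpos (by nlinarith) (by nlinarith)).trans_eq ?_
    rw [← mul_sub, abs_mul, abs_of_pos ht]
  have hphase : |Real.exp (t * z.re) * (1 - Real.cos (t * z.im))| ≤ t * (z.im ^ 2 / (-z.re)) := by
    have hcos := Real.one_sub_sq_div_two_le_cos (x := t * z.im)
    have hcos' := Real.cos_le_one (t * z.im)
    have hdecay : Real.exp (t * z.re) * (t * -z.re) ≤ 1 := by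
      have h := Real.add_one_le_exp (-(t * z.re))
      have h' : Real.exp (t * z.re) * Real.exp (-(t * z.re)) = 1 := by
        rw [← Real.exp_add, add_neg_cancel, Real.exp_zero]
      nlinarith [Real.exp_pos (t * z.re)]
    rw [abs_of_nonneg (mul_nonneg (Real.exp_pos _).le (by linarith)), ← mul_div_assoc,
      le_div_iff₀ (by linarith)]
    calc Real.exp (t * z.re) * (1 - Real.cos (t * z.im)) * -z.re
        ≤ Real.exp (t * z.re) * (t * z.im) ^ 2 * -z.re := by
          gcongr
          · linarith
          · nlinarith [sq_nonneg (t * z.im)]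
      _ = Real.exp (t * z.re) * (t * -z.re) * (t * z.im ^ 2) := by ring
      _ ≤ 1 * (t * z.im ^ 2) := by gcongr
      _ = t * z.im ^ 2 := one_mul _
  rw [hre, mul_add]
  exact (abs_add_le _ _).trans (add_le_add hexp hphase)

lemma tendsto_inv_mul_re_exp_sub_exp (θ : ℝ) (z : ℂ) :
    Tendsto (fun t : ℝ => t⁻¹ *
      (Complex.exp ((t * θ : ℝ) : ℂ) - Complex.exp ((t : ℂ) * z)).re) (𝓝[>] 0)
      (𝓝 (θ - z.re)) := by
  have hderiv : HasDerivAt (fun t : ℂ => Complex.exp (t * θ) - Complex.exp (t * z))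
      ((θ : ℂ) - z) ((0 : ℝ) : ℂ) := by
    have h (c : ℂ) : HasDerivAt (fun t : ℂ => Complex.exp (t * c)) c ((0 : ℝ) : ℂ) := by
      simpa using ((hasDerivAt_id ((0 : ℝ) : ℂ)).mul_const c).cexp
    exact (h θ).sub (h z)
  simpa using hderiv.real_of_complex.tendsto_slope_zero_right

/-- The two integrability facts needed to dominate the difference quotients: the real parts of
the exponents are close, and the phase of `ψ₀` is small relative to its decay. -/
lemma integrableOn_exponent_bounds {C G M Y a : ℝ} (hG : 0 ≤ G) (hM : 1 < M)
    (hY1 : 1 < Y) (hY2 : Y < 2) (ha : 0 < a)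
    (hneg : ∀ w : ℝ, a ≤ w → theta0 C Y w < 0 ∧ (psi0 C G M Y w).re < 0) :
    IntegrableOn (fun w : ℝ => (theta0 C Y w - (psi0 C G M Y w).re) / (w ^ 2 + 1/4))
      (Set.Ioi a) ∧
    IntegrableOn (fun w : ℝ => (psi0 C G M Y w).im ^ 2 / (-(psi0 C G M Y w).re) / (w ^ 2 + 1/4))
      (Set.Ioi a) := by
  have hθc := continuous_theta0 C (by linarith : (0 : ℝ) ≤ Y)
  have hψc := continuous_psi0 C Y hG hM
  have hden : ∀ w : ℝ, w ^ 2 + 1/4 ≠ 0 := fun w => by positivity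
  have hσ : 0 < sigmaY C Y := by
    have h := (hneg a le_rfl).1
    rw [theta0, neg_mul, neg_lt_zero] at h
    exact pos_of_mul_pos_left h (by positivity)
  obtain ⟨K, hK, hψ⟩ := exists_norm_psi0_sub_le C hG hM hY1 hY2
  constructor
  · refine integrableOn_Ioi_of_norm_le_rpow (s := Y - 3) (K := K) ?_ (by linarith) ?_
    · exact ((hθc.sub (continuous_re.comp hψc)).div (by fun_prop) hden).continuousOn
    filter_upwards [hψ, eventually_gt_atTop 0] with w hw hw0
    have hre := (abs_re_le_norm _).trans hw
    simp only [sub_re, ofReal_re, re_mul_ofReal, I_re, zero_mul, sub_zero] at hre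
    have hpow : w ^ (Y - 3) = w ^ (Y - 1) / w ^ 2 := by
      rw [← Real.rpow_natCast, ← Real.rpow_sub hw0]
      norm_num
      ring_nf
    rw [abs_div, abs_sub_comm, abs_of_pos (by positivity : 0 < w ^ 2 + 1/4), hpow,
      ← mul_div_assoc]
    gcongr
    linarith
  · refine integrableOn_Ioi_of_norm_le_rpow (s := -Y)
      (K := (|btilde C G M Y| + K) ^ 2 / (sigmaY C Y / 2)) ?_ (by linarith) ?_
    · refine ((((continuous_im.comp hψc).pow 2).continuousOn.div
        (continuous_re.comp hψc).neg.continuousOn fun w hw => ?_).div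
        (by fun_prop) fun w _ => hden w)
      exact (neg_pos.mpr (hneg w hw).2).ne'
    filter_upwards [hψ, eventually_ge_atTop 1, eventually_ge_atTop (2 * K / sigmaY C Y)]
      with w hw hw1 hwK
    have hw0 : 0 < w := by linarith
    have hsplit : w ^ Y = w ^ (Y - 1) * w := by
      rw [← Real.rpow_add_one hw0.ne']
      ring_nf
    have hre := (abs_re_le_norm _).trans hw
    have him := (abs_im_le_norm _).trans hw
    simp only [sub_re, sub_im, ofReal_re, ofReal_im, re_mul_ofReal, im_mul_ofReal, I_re, I_im,
      zero_mul, one_mul, sub_zero] at hre him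
    have hdecay : sigmaY C Y / 2 * w ^ Y ≤ -(psi0 C G M Y w).re := by
      have h1 := (abs_le.mp hre).2
      rw [theta0, abs_of_pos hw0] at h1
      have h2 : K * w ^ (Y - 1) ≤ sigmaY C Y / 2 * w ^ Y := by
        rw [div_le_iff₀ hσ] at hwK
        rw [hsplit]
        nlinarith [Real.rpow_pos_of_pos hw0 (Y - 1)]
      linarith
    have hphase : |(psi0 C G M Y w).im| ≤ (|btilde C G M Y| + K) * w := by
      have h1 : w ^ (Y - 1) ≤ w := by
        simpa using Real.rpow_le_rpow_of_exponent_le hw1 (by linarith : Y - 1 ≤ 1)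
      have h2 := abs_sub_abs_le_abs_sub (psi0 C G M Y w).im (w * btilde C G M Y)
      rw [abs_mul, abs_of_pos hw0] at h2
      nlinarith
    have hpos : 0 < sigmaY C Y / 2 * w ^ Y := by positivity
    rw [abs_of_nonneg (by have := hpos.trans_le hdecay; positivity)]
    calc (psi0 C G M Y w).im ^ 2 / (-(psi0 C G M Y w).re) / (w ^ 2 + 1/4)
        ≤ ((|btilde C G M Y| + K) * w) ^ 2 / (sigmaY C Y / 2 * w ^ Y) / w ^ 2 := by
          rw [← sq_abs (psi0 C G M Y w).im]
          gcongr
          linarith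
      _ = (|btilde C G M Y| + K) ^ 2 / (sigmaY C Y / 2) * w ^ (-Y) := by
          rw [Real.rpow_neg hw0.le]
          field_simp

/-- Dominated-convergence step for the second-order expansion: if `a > 0` is
such that `θ₀(w) < 0` and `Re ψ₀(w) < 0` for all `w ≥ a`, then
`(1/t)·∫ₐ^∞ Re(exp(t·θ₀(w)) - exp(t·ψ₀(w)))/(w²+1/4) dw →
  ∫ₐ^∞ (θ₀(w) - Re ψ₀(w))/(w²+1/4) dw` as `t → 0⁺`, the limiting integral
being absolutely convergent. -/
theorem stmt19 (C G M Y : ℝ) (hC : 0 < C) (hG : 0 ≤ G) (hM : 1 < M)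
    (hY1 : 1 < Y) (hY2 : Y < 2) (a : ℝ) (ha : 0 < a)
    (hneg : ∀ w : ℝ, a ≤ w → theta0 C Y w < 0 ∧ (psi0 C G M Y w).re < 0) :
    IntegrableOn (fun w : ℝ => (theta0 C Y w - (psi0 C G M Y w).re) / (w ^ 2 + 1/4))
      (Set.Ioi a) ∧
    Tendsto
      (fun t : ℝ => (1/t) *
        ∫ w in Set.Ioi a,
          (Complex.exp (((t * theta0 C Y w : ℝ)) : ℂ)
            - Complex.exp ((t : ℂ) * psi0 C G M Y w)).re / (w ^ 2 + 1/4))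
      (𝓝[>] 0)
      (𝓝 (∫ w in Set.Ioi a, (theta0 C Y w - (psi0 C G M Y w).re) / (w ^ 2 + 1/4))) := by
  obtain ⟨hdiff, hphase⟩ := integrableOn_exponent_bounds hG hM hY1 hY2 ha hneg
  refine ⟨hdiff, ?_⟩
  have hθc := continuous_theta0 C (by linarith : (0 : ℝ) ≤ Y)
  have hψc := continuous_psi0 C Y hG hM
  simp_rw [← integral_const_mul]
  refine tendsto_integral_filter_of_dominated_convergence
    (fun w => |(theta0 C Y w - (psi0 C G M Y w).re) / (w ^ 2 + 1/4)|
      + (psi0 C G M Y w).im ^ 2 / (-(psi0 C G M Y w).re) / (w ^ 2 + 1/4))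
    (Eventually.of_forall fun t => ?_) ?_ (hdiff.abs.add hphase) (Eventually.of_forall fun w => ?_)
  · have hnum : Continuous fun w : ℝ => (Complex.exp (((t * theta0 C Y w : ℝ)) : ℂ)
        - Complex.exp ((t : ℂ) * psi0 C G M Y w)).re := by fun_prop
    exact (continuous_const.mul
      (hnum.div (by fun_prop) fun w => by positivity)).aestronglyMeasurable
  · filter_upwards [self_mem_nhdsWithin] with t (ht : 0 < t)
    filter_upwards [ae_restrict_mem measurableSet_Ioi] with w hw
    obtain ⟨hθ, hψ⟩ := hneg w (Set.mem_Ioi.mp hw).le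
    have hden : 0 < w ^ 2 + 1/4 := by positivity
    rw [Real.norm_eq_abs, abs_mul, abs_of_pos (one_div_pos.mpr ht), abs_div, abs_div,
      abs_of_pos hden, ← add_div, ← mul_div_assoc, one_div_mul_eq_div]
    gcongr
    rw [div_le_iff₀' ht]
    exact abs_re_exp_sub_exp_le ht hθ hψ
  · have h := (tendsto_inv_mul_re_exp_sub_exp (theta0 C Y w) (psi0 C G M Y w)).div_const
      (w ^ 2 + 1/4)
    simpa only [one_div, mul_div_assoc] using h
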